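/- Replacing a contract by its monotone envelope does not change the value function of the manipulation stage: under Assumption 1, for every contract Y with 0 ≤ Y(w) ≤ M for all w ∈ [0, M], defining the monotone envelope Ȳ(x) := sup_{w ∈ [0, x]} Y(w), it holds for every x ∈ [0, M] that sup_{w ∈ [0, M]} (Ȳ(w) − g(w − x)) = sup_{w ∈ [0, M]} (Y(w) − g(w − x)). -/

import Mathlib

/-- Assumption 1: the manipulation technology `g` vanishes for non-positive
manipulations, is convex on `[0, M]`, is differentiable on `(0, M)` with
derivative at least `1`, and tends to `0` as `z → 0⁺`. -/
def Assumption1 (M : ℝ) (g : ℝ → ℝ) : Prop :=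
  (∀ z ≤ (0 : ℝ), g z = 0) ∧
  ConvexOn ℝ (Set.Icc 0 M) g ∧
  (∀ z ∈ Set.Ioo (0 : ℝ) M, DifferentiableAt ℝ g z ∧ 1 ≤ deriv g z) ∧
  Filter.Tendsto g (nhdsWithin 0 (Set.Ioi 0)) (nhds 0)

/-- Monotone envelope of a contract: `Ȳ(x) = sup_{w ∈ [0, x]} Y(w)`. -/
noncomputable def monotoneEnvelope (Y : ℝ → ℝ) (x : ℝ) : ℝ :=
  sSup (Y '' Set.Icc 0 x)

/-- Under `Assumption1`, manipulation costs are nonnegative on `[0, M]`. -/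
theorem Assumption1.nonneg {M : ℝ} {g : ℝ → ℝ} (hg : Assumption1 M g) {z : ℝ}
    (hz : z ∈ Set.Icc 0 M) : 0 ≤ g z := by
  obtain ⟨h0, hconv, hderiv, hlim⟩ := hg
  have hmono : MonotoneOn g (Set.Ioo 0 M) := by
    apply monotoneOn_of_deriv_nonneg (convex_Ioo 0 M)
    · exact fun y hy => (hderiv y hy).1.continuousAt.continuousWithinAt
    · rw [interior_Ioo]
      exact fun y hy => (hderiv y hy).1.differentiableWithinAt
    · rw [interior_Ioo]
      exact fun y hy => zero_le_one.trans (hderiv y hy).2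
  have hpos : ∀ y ∈ Set.Ioo 0 M, 0 ≤ g y := by
    intro y hy
    apply le_of_tendsto hlim
    filter_upwards [Ioo_mem_nhdsGT hy.1] with u hu
    exact hmono ⟨hu.1, hu.2.trans hy.2⟩ hy hu.2.le
  rcases hz.1.eq_or_lt with rfl | hz0
  · exact (h0 0 le_rfl).ge
  have hmid := hconv.2 (Set.left_mem_Icc.2 (hz.1.trans hz.2)) hz
    (by norm_num : (0 : ℝ) ≤ 1 / 2) (by norm_num : (0 : ℝ) ≤ 1 / 2) (by norm_num)
  have hhalf := hpos (1 / 2 * z) ⟨by linarith, by linarith [hz.2]⟩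
  simp only [smul_eq_mul, mul_zero, zero_add, h0 0 le_rfl] at hmid
  linarith

/-- Under `Assumption1`, manipulation costs are nondecreasing on `(-∞, M]`. -/
theorem Assumption1.monotoneOn {M : ℝ} {g : ℝ → ℝ} (hg : Assumption1 M g) (hM : 0 ≤ M) :
    MonotoneOn g (Set.Iic M) := by
  intro y _ z hz hyz
  have hz' : z ≤ M := hz
  rcases le_or_gt z 0 with hz0 | hz0
  · rw [hg.1 y (hyz.trans hz0), hg.1 z hz0]
  have hgz : 0 ≤ g z := hg.nonneg ⟨hz0.le, hz'⟩
  rcases le_or_gt y 0 with hy0 | hy0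
  · rwa [hg.1 y hy0]
  have hyz1 : y / z ≤ 1 := (div_le_one hz0).2 hyz
  have hconv := hg.2.1.2 (Set.left_mem_Icc.2 hM) ⟨hz0.le, hz'⟩
    (sub_nonneg.2 hyz1) (div_nonneg hy0.le hz0.le) (by ring)
  simp only [smul_eq_mul, mul_zero, zero_add, hg.1 0 le_rfl, div_mul_cancel₀ y hz0.ne'] at hconv
  exact hconv.trans (mul_le_of_le_one_left hgz hyz1)

/-- replacing a contract by its monotone envelope does not change
the value function of the manipulation stage. -/
theorem monotone_envelope_same_value_function
    (M : ℝ) (hM : 0 < M) (g : ℝ → ℝ) (hg : Assumption1 M g)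
    (Y : ℝ → ℝ) (hY : ∀ w ∈ Set.Icc (0 : ℝ) M, 0 ≤ Y w ∧ Y w ≤ M) :
    ∀ x ∈ Set.Icc (0 : ℝ) M,
      sSup ((fun w => monotoneEnvelope Y w - g (w - x)) '' Set.Icc 0 M) =
      sSup ((fun w => Y w - g (w - x)) '' Set.Icc 0 M) := by
  intro x hx
  have hmono := hg.monotoneOn hM.le
  have hsub : ∀ w ∈ Set.Icc (0 : ℝ) M, w - x ∈ Set.Iic M :=
    fun w hw => by simpa using hw.2.trans (by linarith [hx.1])
  have hnonneg : ∀ w ∈ Set.Icc (0 : ℝ) M, 0 ≤ g (w - x) := by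
    intro w hw
    rcases le_total (w - x) 0 with h | h
    · exact (hg.1 _ h).ge
    · exact hg.nonneg ⟨h, hsub w hw⟩
  have hYbdd : ∀ w ∈ Set.Icc (0 : ℝ) M, BddAbove (Y '' Set.Icc 0 w) := by
    intro w hw
    refine ⟨M, ?_⟩
    rintro _ ⟨v, hv, rfl⟩
    exact (hY v ⟨hv.1, hv.2.trans hw.2⟩).2
  have hbdd : BddAbove ((fun w => Y w - g (w - x)) '' Set.Icc 0 M) := by
    refine ⟨M, ?_⟩
    rintro _ ⟨w, hw, rfl⟩
    exact (sub_le_self _ (hnonneg w hw)).trans (hY w hw).2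
  have henv_le : ∀ w ∈ Set.Icc (0 : ℝ) M, monotoneEnvelope Y w - g (w - x) ≤
      sSup ((fun w => Y w - g (w - x)) '' Set.Icc 0 M) := by
    intro w hw
    rw [sub_le_iff_le_add]
    apply csSup_le ((Set.nonempty_Icc.2 hw.1).image _)
    rintro _ ⟨v, hv, rfl⟩
    have hv' : v ∈ Set.Icc 0 M := ⟨hv.1, hv.2.trans hw.2⟩
    have hle := le_csSup hbdd (Set.mem_image_of_mem _ hv')
    have hcost := hmono (hsub v hv') (hsub w hw) (sub_le_sub_right hv.2 x)
    linarith
  have hne : (Set.Icc (0 : ℝ) M).Nonempty := Set.nonempty_Icc.2 hM.le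
  apply le_antisymm
  · apply csSup_le (hne.image _)
    rintro _ ⟨w, hw, rfl⟩
    exact henv_le w hw
  · apply csSup_le (hne.image _)
    rintro _ ⟨w, hw, rfl⟩
    have hY_le : Y w ≤ monotoneEnvelope Y w :=
      le_csSup (hYbdd w hw) (Set.mem_image_of_mem _ (Set.right_mem_Icc.2 hw.1))
    have hbdd_env : BddAbove ((fun w => monotoneEnvelope Y w - g (w - x)) '' Set.Icc 0 M) := by
      refine ⟨sSup ((fun w => Y w - g (w - x)) '' Set.Icc 0 M), ?_⟩
      rintro _ ⟨v, hv, rfl⟩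
      exact henv_le v hv
    exact (sub_le_sub_right hY_le _).trans (le_csSup hbdd_env ⟨w, hw, rfl⟩)
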